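/- Let t ≥ 1 be an integer and let σ be an assignment of a parity (odd or even) to each edge of K_t. Then every finite simple graph G that does not admit an immersion of K_t in which, for each edge e of K_t, the branch trail corresponding to e has length of parity σ(e), has a set of edges F ⊆ E(G) such that the subgraph of G with edge set F is bipartite and the graph obtained from G by deleting the edges in F does not admit an immersion of K_{98000·t + 4410071}. -/

import Mathlib

open SimpleGraph

/-- An immersion of `H` in `G`: an injection `φ` of the vertices of `H` into `G`
(the branch vertices), together with, for each edge `uv` of `H`, a trail in `G`
from `φ u` to `φ v` (the branch trails), such that the branch trails are
pairwise edge-disjoint.  The trail assigned to the reversed adjacency is the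
reversed trail, so there is one branch trail per edge of `H`. -/
structure Immersion {V : Type*} {W : Type*} (G : SimpleGraph V) (H : SimpleGraph W) where
  φ : W ↪ V
  trail : ∀ ⦃u v : W⦄, H.Adj u v → G.Walk (φ u) (φ v)
  isTrail : ∀ ⦃u v : W⦄ (h : H.Adj u v), (trail h).IsTrail
  symm : ∀ ⦃u v : W⦄ (h : H.Adj u v), trail h.symm = (trail h).reverse
  disjoint : ∀ ⦃u v a b : W⦄ (h₁ : H.Adj u v) (h₂ : H.Adj a b),
      s(u, v) ≠ s(a, b) → List.Disjoint (trail h₁).edges (trail h₂).edges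

/-- `G` admits an immersion of `H`. -/
def HasImmersion {V W : Type*} (G : SimpleGraph V) (H : SimpleGraph W) : Prop :=
  Nonempty (Immersion G H)

/-- `G` admits a totally odd immersion of `H`: every branch trail has odd length. -/
def HasTotallyOddImmersion {V W : Type*} (G : SimpleGraph V) (H : SimpleGraph W) : Prop :=
  ∃ I : Immersion G H, ∀ ⦃u v : W⦄ (h : H.Adj u v), Odd (I.trail h).length

/-- `G` admits a totally even immersion of `H`: every branch trail has even length. -/
def HasTotallyEvenImmersion {V W : Type*} (G : SimpleGraph V) (H : SimpleGraph W) : Prop :=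
  ∃ I : Immersion G H, ∀ ⦃u v : W⦄ (h : H.Adj u v), Even (I.trail h).length

/-- `G` admits an immersion of K_t with parity pattern σ: for each edge e of K_t, the
corresponding branch trail has length congruent to σ(e) modulo 2. -/
def HasParityPatternImmersion {V : Type*} (G : SimpleGraph V) (t : ℕ)
    (σ : Sym2 (Fin t) → ZMod 2) : Prop :=
  ∃ I : Immersion G (⊤ : SimpleGraph (Fin t)),
    ∀ ⦃u v : Fin t⦄ (h : (⊤ : SimpleGraph (Fin t)).Adj u v),
      ((I.trail h).length : ZMod 2) = σ s(u, v)


section Flow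
open Classical

/-- number of arcs leaving `X` -/
noncomputable def outc {V : Type*} (E : Finset (V × V)) (X : Finset V) : ℕ :=
  ∑ e ∈ E, if e.1 ∈ X ∧ e.2 ∉ X then 1 else 0

/-- number of tokens in `X` -/
noncomputable def tokc {V ι : Type*} (J : Finset ι) (pos : ι → V) (X : Finset V) : ℕ :=
  ∑ i ∈ J, if pos i ∈ X then 1 else 0

/-- the cut condition -/
def FlowOK {V ι : Type*} (E : Finset (V × V)) (cap : V → ℕ) (J : Finset ι) (pos : ι → V) : Prop :=
  ∀ X : Finset V, tokc J pos X ≤ outc E X + ∑ x ∈ X, cap x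

/-- directed walks as lists of arcs -/
def DW {V : Type*} : V → List (V × V) → V → Prop
  | v, [], x => v = x
  | v, a :: l, x => a.1 = v ∧ DW a.2 l x

lemma outc_submod {V : Type*} (E : Finset (V × V)) (X Y : Finset V) :
    outc E (X ∩ Y) + outc E (X ∪ Y) ≤ outc E X + outc E Y := by
  unfold outc
  rw [← Finset.sum_add_distrib, ← Finset.sum_add_distrib]
  apply Finset.sum_le_sum
  intro e _
  by_cases h1 : e.1 ∈ X <;> by_cases h2 : e.2 ∈ X <;> by_cases h3 : e.1 ∈ Y <;>
    by_cases h4 : e.2 ∈ Y <;> simp [h1, h2, h3, h4]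

lemma outc_submod_lt {V : Type*} (E : Finset (V × V)) (X Y : Finset V) (a b : V)
    (hab : (a, b) ∈ E) (haX : a ∈ X) (haY : a ∉ Y) (hbX : b ∉ X) (hbY : b ∈ Y) :
    outc E (X ∩ Y) + outc E (X ∪ Y) < outc E X + outc E Y := by
  unfold outc
  rw [← Finset.sum_add_distrib, ← Finset.sum_add_distrib]
  apply Finset.sum_lt_sum
  · intro e _
    by_cases h1 : e.1 ∈ X <;> by_cases h2 : e.2 ∈ X <;> by_cases h3 : e.1 ∈ Y <;>
      by_cases h4 : e.2 ∈ Y <;> simp [h1, h2, h3, h4]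
  · exact ⟨(a, b), hab, by simp [haX, haY, hbX, hbY]⟩

lemma tokc_mod {V ι : Type*} (J : Finset ι) (pos : ι → V) (X Y : Finset V) :
    tokc J pos (X ∩ Y) + tokc J pos (X ∪ Y) = tokc J pos X + tokc J pos Y := by
  unfold tokc
  rw [← Finset.sum_add_distrib, ← Finset.sum_add_distrib]
  apply Finset.sum_congr rfl
  intro e _
  by_cases h1 : pos e ∈ X <;> by_cases h3 : pos e ∈ Y <;> simp [h1, h3]

lemma cap_mod {V : Type*} (cap : V → ℕ) (X Y : Finset V) :
    (∑ x ∈ X ∩ Y, cap x) + (∑ x ∈ X ∪ Y, cap x) = (∑ x ∈ X, cap x) + ∑ x ∈ Y, cap x := by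
  rw [add_comm, Finset.sum_union_inter]

lemma outc_erase {V : Type*} (E : Finset (V × V)) (X : Finset V) (a b : V) (h : (a, b) ∈ E) :
    outc E X = outc (E.erase (a, b)) X + if a ∈ X ∧ b ∉ X then 1 else 0 := by
  unfold outc
  rw [← Finset.sum_erase_add _ _ h]

lemma flow_antisymm {V ι : Type*} (E : Finset (V × V)) (cap : V → ℕ) (J : Finset ι) (pos : ι → V)
    (h : FlowOK E cap J pos) :
    ∃ E' ⊆ E, FlowOK E' cap J pos ∧ ∀ a b, (a, b) ∈ E' → (b, a) ∉ E' ∨ a = b := by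
  induction hn : E.card using Nat.strong_induction_on generalizing E with
  | _ n ih =>
  by_cases hc : ∃ x ∈ E, FlowOK (E.erase x) cap J pos
  · obtain ⟨x, hx, hf⟩ := hc
    obtain ⟨E', h1, h2⟩ := ih _ (by rw [← hn]; exact Finset.card_erase_lt_of_mem hx) _ hf rfl
    exact ⟨E', h1.trans (Finset.erase_subset _ _), h2⟩
  push Not at hc
  refine ⟨E, subset_rfl, h, ?_⟩
  have key : ∀ a b, (a, b) ∈ E → ∃ X : Finset V, a ∈ X ∧ b ∉ X ∧
      tokc J pos X = outc E X + ∑ x ∈ X, cap x := by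
    intro a b hab
    have := hc _ hab
    unfold FlowOK at this
    push Not at this
    obtain ⟨X, hX⟩ := this
    have h1 := outc_erase E X a b hab
    have h2 := h X
    by_cases h3 : a ∈ X ∧ b ∉ X
    · refine ⟨X, h3.1, h3.2, ?_⟩
      rw [if_pos h3] at h1
      omega
    · rw [if_neg h3] at h1
      omega
  intro a b hab
  by_contra hcon
  push Not at hcon
  obtain ⟨X, haX, hbX, hX⟩ := key a b hab
  obtain ⟨Y, hbY, haY, hY⟩ := key b a hcon.1
  have h1 := outc_submod_lt E X Y a b hab haX haY hbX hbY
  have h2 := tokc_mod J pos X Y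
  have h3 := cap_mod cap X Y
  have h4 := h (X ∩ Y)
  have h5 := h (X ∪ Y)
  omega

lemma flow_exists {V ι : Type*} [Fintype V] (E : Finset (V × V)) (cap : V → ℕ) (J : Finset ι)
    (pos : ι → V) (h : FlowOK E cap J pos) :
    ∃ (L : ι → List (V × V)) (e : ι → V),
      (∀ i ∈ J, DW (pos i) (L i) (e i) ∧ (L i).Nodup ∧ ∀ a ∈ L i, a ∈ E) ∧
      (∀ i ∈ J, ∀ j ∈ J, i ≠ j → List.Disjoint (L i) (L j)) ∧
      ∀ x, (J.filter (fun i => e i = x)).card ≤ cap x := by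
  induction hn : E.card + J.card using Nat.strong_induction_on generalizing E cap J pos with
  | _ n ih =>
  obtain rfl | ⟨i, hi⟩ := J.eq_empty_or_nonempty
  · exact ⟨fun _ => [], pos, by simp⟩
  have htokE : ∀ X, tokc J pos X = tokc (J.erase i) pos X + if pos i ∈ X then 1 else 0 := by
    intro X
    unfold tokc
    rw [← Finset.sum_erase_add _ _ hi]
  by_cases hcap : 0 < cap (pos i)
  · have hJ := Finset.card_erase_lt_of_mem hi
    obtain ⟨L, e, h1, h2, h3⟩ := ih (E.card + (J.erase i).card) (by omega) E
      (Function.update cap (pos i) (cap (pos i) - 1)) (J.erase i) pos (by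
        intro X
        have hX := h X
        rw [htokE] at hX
        by_cases hv : pos i ∈ X
        · rw [if_pos hv] at hX
          rw [Finset.sum_update_of_mem hv]
          have := Finset.sum_erase_add X cap hv
          rw [Finset.sdiff_singleton_eq_erase]
          omega
        · rw [if_neg hv] at hX
          rw [Finset.sum_update_of_notMem hv]
          omega) rfl
    refine ⟨Function.update L i [], Function.update e i (pos i), ?_, ?_, ?_⟩
    · intro j hj
      by_cases hji : j = i
      · subst hji; simp [DW]
      · simpa [hji] using h1 j (by simp [hji, hj])
    · intro j hj k hk hjk
      by_cases hji : j = i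
      · subst hji; simp
      · by_cases hki : k = i
        · subst hki; simp
        · simpa [hji, hki] using h2 j (by simp [hji, hj]) k (by simp [hki, hk]) hjk
    · intro x
      have hx := h3 x
      have hle : (J.filter (fun j => Function.update e i (pos i) j = x)).card ≤
          ((J.erase i).filter (fun j => e j = x)).card + if pos i = x then 1 else 0 := by
        by_cases hpx : pos i = x
        · rw [if_pos hpx]
          refine (Finset.card_le_card ?_).trans (Finset.card_insert_le i _)
          intro j hj
          by_cases hji : j = i <;> simp_all
        · rw [if_neg hpx]
          apply Finset.card_le_card
          intro j hj
          by_cases hji : j = i <;> simp_all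
      by_cases hpx : pos i = x
      · subst hpx
        simp at hx hle
        omega
      · rw [Function.update_of_ne (Ne.symm hpx)] at hx
        simp [hpx] at hle
        omega
  · -- move the token along an arc
    have hcap0 : cap (pos i) = 0 := by omega
    let tight : Finset V → Prop := fun X =>
      tokc J pos X = outc E X + (∑ x ∈ X, cap x) ∧ pos i ∉ X
    have hem : tight ∅ := by
      simp [tight, tokc, outc]
    obtain ⟨T, hT, hTmax⟩ := Finset.exists_max_image (Finset.univ.filter tight) Finset.card
      ⟨∅, by simp [hem]⟩
    have hT' : tight T := by simpa using hT
    obtain ⟨w, hw, hwT⟩ : ∃ w, (pos i, w) ∈ E ∧ w ∉ T ∧ w ≠ pos i := by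
      by_contra hcon
      push Not at hcon
      have h1 := h (insert (pos i) T)
      rw [Finset.sum_insert hT'.2] at h1
      have h2 : tokc J pos T + 1 ≤ tokc J pos (insert (pos i) T) := by
        rw [htokE, htokE, if_neg hT'.2, if_pos (by simp)]
        have : tokc (J.erase i) pos T ≤ tokc (J.erase i) pos (insert (pos i) T) := by
          unfold tokc
          apply Finset.sum_le_sum
          intro j _
          by_cases hj : pos j ∈ T <;> simp [hj]
        omega
      have h3 : outc E (insert (pos i) T) ≤ outc E T := by
        unfold outc
        apply Finset.sum_le_sum
        rintro ⟨a, b⟩ hab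
        by_cases ha : a = pos i
        · subst ha
          have := hcon b hab
          by_cases hb : b ∈ T
          · simp [hb]
          · simp [this hb]
        · by_cases hb : b ∈ T <;> by_cases ha' : a ∈ T <;> simp [ha, hb, ha']
          split_ifs <;> simp
      have := hT'.1
      omega
    have hnt : ∀ X, w ∈ X → pos i ∉ X → tokc J pos X < outc E X + ∑ x ∈ X, cap x := by
      intro X hwX hvX
      refine lt_of_le_of_ne (h X) fun heq => ?_
      have ht : tight (T ∪ X) := by
        refine ⟨?_, by simp [hvX, hT'.2]⟩
        have h1 := outc_submod E T X
        have h2 := tokc_mod J pos T X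
        have h3 := cap_mod cap T X
        have h4 := h (T ∩ X)
        have h5 := h (T ∪ X)
        have := hT'.1
        omega
      have := hTmax _ (by simpa using ht)
      have h6 : T = T ∪ X := Finset.eq_of_subset_of_card_le Finset.subset_union_left this
      exact hwT.1 (h6 ▸ Finset.mem_union_right _ hwX)
    have hE := Finset.card_erase_lt_of_mem hw
    obtain ⟨L, e, h1, h2, h3⟩ := ih ((E.erase (pos i, w)).card + J.card) (by omega)
      (E.erase (pos i, w)) cap J (Function.update pos i w) (by
        intro X
        have hX := h X
        have hE := outc_erase E X (pos i) w hw
        have e1 : tokc J (Function.update pos i w) X =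
            tokc (J.erase i) pos X + if w ∈ X then 1 else 0 := by
          unfold tokc
          rw [← Finset.sum_erase_add _ _ hi]
          simp only [Function.update_self]
          congr 1
          apply Finset.sum_congr rfl
          intro j hj
          rw [Function.update_of_ne (Finset.ne_of_mem_erase hj)]
        have e2 := htokE X
        by_cases hv : pos i ∈ X <;> by_cases hwX : w ∈ X
        · simp [hv, hwX] at *; omega
        · simp [hv, hwX] at *; omega
        · have := hnt X hwX hv
          simp [hv, hwX] at *; omega
        · simp [hv, hwX] at *; omega) rfl
    refine ⟨Function.update L i ((pos i, w) :: L i), e, ?_, ?_, h3⟩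
    · intro j hj
      have := h1 j hj
      by_cases hji : j = i
      · subst hji
        simp only [Function.update_self] at this ⊢
        refine ⟨⟨rfl, this.1⟩, ?_, ?_⟩
        · rw [List.nodup_cons]
          exact ⟨fun hm => by simpa using this.2.2 _ hm, this.2.1⟩
        · intro a ha
          rcases List.mem_cons.1 ha with rfl | ha
          · exact hw
          · exact Finset.mem_of_mem_erase (this.2.2 _ ha)
      · simp only [Function.update_of_ne hji] at this ⊢
        exact ⟨this.1, this.2.1, fun a ha => Finset.mem_of_mem_erase (this.2.2 _ ha)⟩
    · have hnot : ∀ k ∈ J, (pos i, w) ∉ L k := fun k hk hm => by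
        simpa using (h1 k hk).2.2 _ hm
      intro j hj k hk hjk
      have := h2 j hj k hk hjk
      by_cases hji : j = i
      · subst hji
        rw [Function.update_self, Function.update_of_ne (Ne.symm hjk), List.disjoint_cons_left]
        exact ⟨hnot k hk, this⟩
      · by_cases hki : k = i
        · subst hki
          rw [Function.update_self, Function.update_of_ne hji, List.disjoint_cons_right]
          exact ⟨hnot j hj, this⟩
        · rwa [Function.update_of_ne hji, Function.update_of_ne hki]

lemma DW_walk {V : Type*} (G : SimpleGraph V) (l : List (V × V)) (v x : V) (h : DW v l x)
    (hl : ∀ a ∈ l, G.Adj a.1 a.2) :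
    ∃ W : G.Walk v x, W.edges = l.map (fun a => s(a.1, a.2)) := by
  induction l generalizing v with
  | nil => obtain rfl : v = x := h; exact ⟨Walk.nil, rfl⟩
  | cons a l ih =>
    obtain ⟨rfl, h⟩ := h
    obtain ⟨W, hW⟩ := ih _ h (fun b hb => hl b (List.mem_cons_of_mem _ hb))
    exact ⟨Walk.cons (hl a (by simp)) W, by simp [hW]⟩

/-- edge-disjoint trails from tokens to sinks in an undirected graph -/
lemma flow_graph {V ι : Type*} [Fintype V] [Fintype ι] (G : SimpleGraph V) (cap : V → ℕ)
    (pos : ι → V)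
    (h : ∀ X : Finset V, (Finset.univ.filter (fun i => pos i ∈ X)).card ≤
      (Finset.univ.filter (fun e : V × V => G.Adj e.1 e.2 ∧ e.1 ∈ X ∧ e.2 ∉ X)).card +
        ∑ x ∈ X, cap x) :
    ∃ (e : ι → V) (W : ∀ i, G.Walk (pos i) (e i)), (∀ i, (W i).IsTrail) ∧
      (∀ i j, i ≠ j → List.Disjoint (W i).edges (W j).edges) ∧
      ∀ x, (Finset.univ.filter (fun i => e i = x)).card ≤ cap x := by
  obtain ⟨E, hE, hE1, hE2⟩ := flow_antisymm
    (Finset.univ.filter (fun e : V × V => G.Adj e.1 e.2)) cap Finset.univ pos (by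
      intro X
      have := h X
      unfold tokc outc
      rw [Finset.sum_boole, Finset.sum_boole, Finset.filter_filter]
      simpa using this)
  have hadj : ∀ a ∈ E, G.Adj a.1 a.2 := fun a ha => by simpa using hE ha
  have hinj : ∀ a ∈ E, ∀ b ∈ E, s(a.1, a.2) = s(b.1, b.2) → a = b := by
    rintro ⟨a, b⟩ ha ⟨c, d⟩ hc heq
    rw [Sym2.eq_iff] at heq
    rcases heq with ⟨h1, h2⟩ | ⟨h1, h2⟩
    · simp_all
    · simp only at h1 h2
      subst h1; subst h2
      rcases hE2 _ _ ha with h | h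
      · exact absurd hc h
      · simp [h]
  obtain ⟨L, e, h1, h2, h3⟩ := flow_exists E cap Finset.univ pos hE1
  choose W hW using fun i => DW_walk G (L i) (pos i) (e i) (h1 i (by simp)).1
    (fun a ha => hadj a ((h1 i (by simp)).2.2 a ha))
  refine ⟨e, W, ?_, ?_, h3⟩
  · intro i
    rw [Walk.isTrail_def, hW]
    apply List.Nodup.map_on _ (h1 i (by simp)).2.1
    intro a ha b hb hab
    exact hinj a ((h1 i (by simp)).2.2 a ha) b ((h1 i (by simp)).2.2 b hb) hab
  · intro i j hij
    rw [hW, hW]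
    intro x hx hy
    obtain ⟨a, ha, rfl⟩ := List.mem_map.1 hx
    obtain ⟨b, hb, hab⟩ := List.mem_map.1 hy
    have := hinj b ((h1 j (by simp)).2.2 b hb) a ((h1 i (by simp)).2.2 a ha) hab
    subst this
    exact h2 i (by simp) j (by simp) hij ha hb

end Flow

section Comb
open Classical

/-- the three edges of a route -/
noncomputable def redg {W ι : Type*} (a b r r' : ι → W) (i : ι) : Finset (Sym2 W) :=
  {s(a i, r i), s(r i, r' i), s(r' i, b i)}

lemma overload_card {W ι : Type*} [Fintype W] (t : ℕ) (ht : 1 ≤ t) (J : Finset ι)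
    (hJ : J.card ≤ t * t) (r : ι → W) :
    (Finset.univ.filter (fun x => t ≤ (J.filter (fun j => r j = x)).card)).card ≤ t := by
  set B := Finset.univ.filter (fun x => t ≤ (J.filter (fun j => r j = x)).card) with hB
  have h1 : B.card * t ≤ ∑ x ∈ B, (J.filter (fun j => r j = x)).card := by
    rw [← smul_eq_mul]
    apply Finset.card_nsmul_le_sum
    intro x hx
    simpa [hB] using hx
  have h2 : ∑ x ∈ B, (J.filter (fun j => r j = x)).card ≤ J.card := by
    rw [← Finset.card_biUnion]
    · apply Finset.card_le_card
      intro j hj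
      simp at hj
      exact hj.2
    · intro x _ y _ hxy
      rw [Function.onFun, Finset.disjoint_left]
      intro j hj hj'
      simp at hj hj'
      exact hxy (hj.2.symm.trans hj'.2)
  have : B.card * t ≤ t * t := by omega
  exact Nat.le_of_mul_le_mul_right this (by omega)

lemma routing_aux {W ι : Type*} [Fintype W] [Fintype ι] (t : ℕ) (ht : 1 ≤ t)
    (a b : ι → W) (O : ι → Finset (W × W)) (hι : Fintype.card ι ≤ t * t)
    (ha : ∀ x, (Finset.univ.filter (fun i => a i = x)).card ≤ t)
    (hb : ∀ x, (Finset.univ.filter (fun i => b i = x)).card ≤ t)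
    (hO : ∀ i, 14 * t * Fintype.card W + 6 * (t * t) < (O i).card) (J : Finset ι) :
    ∃ r r' : ι → W, (∀ i ∈ J, (r i, r' i) ∈ O i) ∧
      (∀ i ∈ J, ∀ j ∈ J, i ≠ j → Disjoint (redg a b r r' i) (redg a b r r' j)) ∧
      (∀ x, (J.filter (fun j => r j = x)).card ≤ t) ∧
      (∀ x, (J.filter (fun j => r' j = x)).card ≤ t) := by
  induction J using Finset.induction_on with
  | empty =>
    have hne : ∀ i, ∃ x, x ∈ O i := fun i =>
      Finset.card_pos.1 (lt_of_le_of_lt (Nat.zero_le _) (hO i))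
    choose f _ using hne
    exact ⟨fun i => (f i).1, fun i => (f i).2, by simp⟩
  | insert k J hk ih =>
    obtain ⟨r, r', h1, h2, h3, h4⟩ := ih
    have hJ : J.card ≤ t * t := (Finset.card_le_univ J).trans hι
    set U := J.biUnion (redg a b r r') with hU
    let B1 := Finset.univ.filter (fun x => t ≤ (J.filter (fun j => r j = x)).card)
    let B2 := Finset.univ.filter (fun x => t ≤ (J.filter (fun j => r' j = x)).card)
    have hB1 : B1.card ≤ t := overload_card t ht J hJ r
    have hB2 : B2.card ≤ t := overload_card t ht J hJ r'
    let NB : W → Finset W := fun x => Finset.univ.filter (fun y => s(x, y) ∈ U)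
    have hNB : ∀ x, (NB x).card ≤ 6 * t := by
      intro x
      have hsub : NB x ⊆ (J.filter (fun j => a j = x)).image r ∪
          ((J.filter (fun j => r j = x)).image a ∪
          ((J.filter (fun j => r j = x)).image r' ∪
          ((J.filter (fun j => r' j = x)).image r ∪
          ((J.filter (fun j => r' j = x)).image b ∪
          (J.filter (fun j => b j = x)).image r')))) := by
        intro y hy
        simp only [NB, hU, redg, Finset.mem_filter, Finset.mem_univ, true_and,
          Finset.mem_biUnion, Finset.mem_insert, Finset.mem_singleton, Sym2.eq_iff] at hy
        simp only [Finset.mem_union, Finset.mem_image, Finset.mem_filter]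
        obtain ⟨j, hj, hy⟩ := hy
        rcases hy with (⟨hx, hy⟩ | ⟨hx, hy⟩) | (⟨hx, hy⟩ | ⟨hx, hy⟩) | (⟨hx, hy⟩ | ⟨hx, hy⟩)
        · exact Or.inl ⟨j, ⟨hj, hx.symm⟩, hy.symm⟩
        · exact Or.inr (Or.inl ⟨j, ⟨hj, hx.symm⟩, hy.symm⟩)
        · exact Or.inr (Or.inr (Or.inl ⟨j, ⟨hj, hx.symm⟩, hy.symm⟩))
        · exact Or.inr (Or.inr (Or.inr (Or.inl ⟨j, ⟨hj, hx.symm⟩, hy.symm⟩)))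
        · exact Or.inr (Or.inr (Or.inr (Or.inr (Or.inl ⟨j, ⟨hj, hx.symm⟩, hy.symm⟩))))
        · exact Or.inr (Or.inr (Or.inr (Or.inr (Or.inr ⟨j, ⟨hj, hx.symm⟩, hy.symm⟩))))
      have hJs : ∀ f : ι → W, (J.filter (fun j => f j = x)).card ≤
          (Finset.univ.filter (fun j => f j = x)).card := fun f =>
        Finset.card_le_card (Finset.filter_subset_filter _ (Finset.subset_univ _))
      have c1 := (Finset.card_image_le (s := J.filter (fun j => a j = x)) (f := r)).trans
        ((hJs a).trans (ha x))
      have c2 := (Finset.card_image_le (s := J.filter (fun j => r j = x)) (f := a)).trans (h3 x)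
      have c3 := (Finset.card_image_le (s := J.filter (fun j => r j = x)) (f := r')).trans (h3 x)
      have c4 := (Finset.card_image_le (s := J.filter (fun j => r' j = x)) (f := r)).trans (h4 x)
      have c5 := (Finset.card_image_le (s := J.filter (fun j => r' j = x)) (f := b)).trans (h4 x)
      have c6 := (Finset.card_image_le (s := J.filter (fun j => b j = x)) (f := r')).trans
        ((hJs b).trans (hb x))
      refine (Finset.card_le_card hsub).trans ?_
      refine (Finset.card_union_le _ _).trans ?_
      have d1 := Finset.card_union_le ((J.filter (fun j => r j = x)).image a)
          ((J.filter (fun j => r j = x)).image r' ∪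
          ((J.filter (fun j => r' j = x)).image r ∪
          ((J.filter (fun j => r' j = x)).image b ∪
          (J.filter (fun j => b j = x)).image r')))
      have d2 := Finset.card_union_le ((J.filter (fun j => r j = x)).image r')
          ((J.filter (fun j => r' j = x)).image r ∪
          ((J.filter (fun j => r' j = x)).image b ∪
          (J.filter (fun j => b j = x)).image r'))
      have d3 := Finset.card_union_le ((J.filter (fun j => r' j = x)).image r)
          ((J.filter (fun j => r' j = x)).image b ∪
          (J.filter (fun j => b j = x)).image r')
      have d4 := Finset.card_union_le ((J.filter (fun j => r' j = x)).image b)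
          ((J.filter (fun j => b j = x)).image r')
      omega
    let Q : Finset (W × W) := Finset.univ.filter (fun z => s(z.1, z.2) ∈ U)
    have hQ : Q.card ≤ 6 * (t * t) := by
      have hsub : Q ⊆ J.biUnion (fun j => {(a j, r j), (r j, a j), (r j, r' j), (r' j, r j),
          (r' j, b j), (b j, r' j)}) := by
        rintro ⟨x, y⟩ hy
        simp only [Q, hU, redg, Finset.mem_filter, Finset.mem_univ, true_and,
          Finset.mem_biUnion, Finset.mem_insert, Finset.mem_singleton, Sym2.eq_iff] at hy
        simp only [Finset.mem_biUnion, Finset.mem_insert, Finset.mem_singleton, Prod.mk.injEq]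
        obtain ⟨j, hj, hy⟩ := hy
        exact ⟨j, hj, by tauto⟩
      refine (Finset.card_le_card hsub).trans ?_
      refine (Finset.card_biUnion_le_card_mul J _ 6 ?_).trans (by omega)
      intro j _
      exact Finset.card_le_six
    obtain ⟨⟨x, y⟩, hxyO, hxy⟩ : ∃ z ∈ O k, z ∉ (B1 ×ˢ Finset.univ) ∪ ((Finset.univ ×ˢ B2) ∪
        ((NB (a k) ×ˢ Finset.univ) ∪ ((Finset.univ ×ˢ NB (b k)) ∪ Q))) := by
      apply Finset.exists_mem_notMem_of_card_lt_card
      refine lt_of_le_of_lt ?_ (hO k)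
      refine (Finset.card_union_le _ _).trans ?_
      have d1 := Finset.card_union_le ((Finset.univ : Finset W) ×ˢ B2)
        ((NB (a k) ×ˢ (Finset.univ : Finset W)) ∪ (((Finset.univ : Finset W) ×ˢ NB (b k)) ∪ Q))
      have d2 := Finset.card_union_le (NB (a k) ×ˢ (Finset.univ : Finset W))
        (((Finset.univ : Finset W) ×ˢ NB (b k)) ∪ Q)
      have d3 := Finset.card_union_le ((Finset.univ : Finset W) ×ˢ NB (b k)) Q
      have e1 := hNB (a k)
      have e2 := hNB (b k)
      have f1 := Nat.mul_le_mul_right (Fintype.card W) hB1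
      have f2 := Nat.mul_le_mul_right (Fintype.card W) hB2
      have f3 := Nat.mul_le_mul_right (Fintype.card W) e1
      have f4 := Nat.mul_le_mul_right (Fintype.card W) e2
      simp only [Finset.card_product, Finset.card_univ] at d1 d2 d3 ⊢
      rw [mul_comm (Fintype.card W) B2.card] at d1
      rw [mul_comm (Fintype.card W) (NB (b k)).card] at d3
      nlinarith
    simp only [Finset.mem_union, Finset.mem_product, Finset.mem_univ, and_true, true_and,
      not_or] at hxy
    obtain ⟨g1, g2, g3, g4, g5⟩ := hxy
    have g1' : (J.filter (fun j => r j = x)).card < t := by simpa [B1] using g1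
    have g2' : (J.filter (fun j => r' j = y)).card < t := by simpa [B2] using g2
    have g3' : s(a k, x) ∉ U := by simpa [NB] using g3
    have g4' : s(b k, y) ∉ U := by simpa [NB] using g4
    have g5' : s(x, y) ∉ U := by simpa [Q] using g5
    have hredg : ∀ j ∈ J, redg a b (Function.update r k x) (Function.update r' k y) j =
        redg a b r r' j := by
      intro j hj
      have : j ≠ k := fun h => hk (h ▸ hj)
      simp [redg, this]
    have hnew : ∀ j ∈ J, Disjoint (redg a b (Function.update r k x) (Function.update r' k y) k)
        (redg a b r r' j) := by
      intro j hj
      rw [Finset.disjoint_left]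
      intro e he he'
      have heU : e ∈ U := Finset.mem_biUnion.2 ⟨j, hj, he'⟩
      simp only [redg, Function.update_self, Finset.mem_insert, Finset.mem_singleton] at he
      rcases he with rfl | rfl | rfl
      · exact g3' heU
      · exact g5' heU
      · exact g4' (Sym2.eq_swap ▸ heU)
    have hload : ∀ (f : ι → W) (x : W), (∀ z, (J.filter (fun j => f j = z)).card ≤ t) →
        (J.filter (fun j => f j = x)).card < t →
        ∀ z, ((insert k J).filter (fun j => Function.update f k x j = z)).card ≤ t := by
      intro f x hf hx z
      have hsame : J.filter (fun j => Function.update f k x j = z) =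
          J.filter (fun j => f j = z) := by
        apply Finset.filter_congr
        intro j hj
        have : j ≠ k := fun h => hk (h ▸ hj)
        simp [this]
      rw [Finset.filter_insert, hsame]
      split_ifs with hz
      · simp only [Function.update_self] at hz
        subst hz
        exact (Finset.card_insert_le _ _).trans hx
      · exact hf z
    refine ⟨Function.update r k x, Function.update r' k y, ?_, ?_, hload r x h3 g1',
      hload r' y h4 g2'⟩
    · intro i hi
      rcases Finset.mem_insert.1 hi with rfl | hi
      · simpa using hxyO
      · have : i ≠ k := fun h => hk (h ▸ hi)
        simpa [this] using h1 i hi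
    · intro i hi j hj hij
      rcases Finset.mem_insert.1 hi with rfl | hi'
      · rcases Finset.mem_insert.1 hj with rfl | hj'
        · exact absurd rfl hij
        · rw [hredg j hj']; exact hnew j hj'
      · rcases Finset.mem_insert.1 hj with rfl | hj'
        · rw [hredg i hi']; exact (hnew i hi').symm
        · rw [hredg i hi', hredg j hj']; exact h2 i hi' j hj' hij

lemma routing {W ι : Type*} [Fintype W] [Fintype ι] (t : ℕ) (ht : 1 ≤ t)
    (a b : ι → W) (O : ι → Finset (W × W)) (hι : Fintype.card ι ≤ t * t)
    (ha : ∀ x, (Finset.univ.filter (fun i => a i = x)).card ≤ t)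
    (hb : ∀ x, (Finset.univ.filter (fun i => b i = x)).card ≤ t)
    (hO : ∀ i, 14 * t * Fintype.card W + 6 * (t * t) < (O i).card) :
    ∃ r r' : ι → W, (∀ i, (r i, r' i) ∈ O i) ∧
      (∀ i j, i ≠ j → Disjoint (redg a b r r' i) (redg a b r r' j)) := by
  obtain ⟨r, r', h1, h2, _⟩ := routing_aux t ht a b O hι ha hb hO Finset.univ
  exact ⟨r, r', fun i => h1 i (by simp), fun i j => h2 i (by simp) j (by simp)⟩

/-- routes from `u` to `v` of given parity -/
noncomputable def Oset {W : Type*} [Fintype W] (p : W → W → ZMod 2) (u v : W) (b : ZMod 2) :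
    Finset (W × W) :=
  Finset.univ.filter (fun z => z.1 ≠ u ∧ z.1 ≠ v ∧ z.2 ≠ u ∧ z.2 ≠ v ∧ z.1 ≠ z.2 ∧
    p u z.1 + p z.1 z.2 + p z.2 v = b)

/-- pairs of wrong parity in `C` -/
noncomputable def Bset {W : Type*} (p : W → W → ZMod 2) (q : ZMod 2) (C : Finset W) :
    Finset (W × W) :=
  (C ×ˢ C).filter (fun z => z.1 ≠ z.2 ∧ p z.1 z.2 ≠ q)

lemma zmod2_aux : ∀ b x y c : ZMod 2, c ≠ b + 1 + x + y → x + c + y = b := by decide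

lemma near_const {W : Type*} [Fintype W] (p : W → W → ZMod 2) (u v : W) (b : ZMod 2)
    (h : 1600 * (Oset p u v b).card < Fintype.card W ^ 2) :
    ∃ (q : ZMod 2) (C : Finset W), Fintype.card W ≤ 4 * C.card + 2 ∧
      1600 * (Bset p q C).card < Fintype.card W ^ 2 := by
  let S : Finset W := Finset.univ \ {u, v}
  have hS : Fintype.card W ≤ S.card + 2 := by
    have h1 := Finset.le_card_sdiff ({u, v} : Finset W) Finset.univ
    have h2 : ({u, v} : Finset W).card ≤ 2 := Finset.card_le_two
    rw [Finset.card_univ] at h1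
    change Fintype.card W - _ ≤ S.card at h1
    omega
  let f : W → ZMod 2 × ZMod 2 := fun r => (p u r, p r v)
  obtain ⟨⟨x, y⟩, hxy⟩ : ∃ z : ZMod 2 × ZMod 2, S.card ≤ 4 * (S.filter (fun r => f r = z)).card := by
    by_contra hcon
    push Not at hcon
    have h1 : S.card = ∑ z : ZMod 2 × ZMod 2, (S.filter (fun r => f r = z)).card :=
      Finset.card_eq_sum_card_fiberwise (by intro r _; simp)
    have h2 : ∑ z : ZMod 2 × ZMod 2, 4 * (S.filter (fun r => f r = z)).card <
        ∑ z : ZMod 2 × ZMod 2, S.card :=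
      Finset.sum_lt_sum_of_nonempty ⟨(0, 0), by simp⟩ (fun z _ => hcon z)
    rw [← Finset.mul_sum, ← h1] at h2
    simp at h2
  refine ⟨b + 1 + x + y, S.filter (fun r => f r = (x, y)), by omega, ?_⟩
  refine lt_of_le_of_lt (Nat.mul_le_mul_left _ (Finset.card_le_card ?_)) h
  rintro ⟨r, r'⟩ hr
  simp only [Bset, S, f, Finset.mem_filter, Finset.mem_product, Finset.mem_sdiff, Finset.mem_univ,
    true_and, Finset.mem_insert, Finset.mem_singleton, not_or, Prod.mk.injEq] at hr
  obtain ⟨⟨⟨⟨a1, a2⟩, a3, a4⟩, ⟨a5, a6⟩, a7, a8⟩, a9, a10⟩ := hr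
  simp only [Oset, Finset.mem_filter, Finset.mem_univ, true_and]
  refine ⟨a1, a2, a5, a6, a9, ?_⟩
  rw [a3, a8]
  exact zmod2_aux _ _ _ _ a10

/-- routes avoiding `Z` with all parities `q` -/
noncomputable def O2set {W : Type*} (p : W → W → ZMod 2) (q : ZMod 2) (C Z : Finset W)
    (a b : W) : Finset (W × W) :=
  (C ×ˢ C).filter (fun z => z.1 ∉ Z ∧ z.2 ∉ Z ∧ z.1 ≠ z.2 ∧ p a z.1 = q ∧ p z.1 z.2 = q ∧
    p z.2 b = q)

lemma good_vertices {W : Type*} [Fintype W] (t : ℕ)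
    (hN : 98000 * t + 4410071 ≤ Fintype.card W)
    (p : W → W → ZMod 2) (hp : ∀ x y, p x y = p y x) (q : ZMod 2) (C : Finset W)
    (hC : Fintype.card W ≤ 4 * C.card + 2)
    (hB : 1600 * (Bset p q C).card < Fintype.card W ^ 2) :
    ∃ Gd : Finset W, 2 * t ≤ Gd.card ∧ ∀ Z : Finset W, Z.card ≤ 2 * t → ∀ a ∈ Gd, ∀ b ∈ Gd,
      a ∈ Z → b ∈ Z →
      14 * t * Fintype.card W + 6 * (t * t) < (O2set p q C Z a b).card := by
  set N := Fintype.card W with hNdef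
  set n := C.card with hn
  set β := (Bset p q C).card with hβ
  let bad : W → Finset W := fun x => C.filter (fun y => x ≠ y ∧ p x y ≠ q)
  let Gd := C.filter (fun x => 10 * (bad x).card ≤ n)
  have hnt : 24500 * t + 1102517 ≤ n := by omega
  have hβ2 : 1600 * β < (4 * n + 2) ^ 2 := hB.trans_le (Nat.pow_le_pow_left hC 2)
  refine ⟨Gd, ?_, ?_⟩
  · -- few vertices are not good
    have h1 : (C \ Gd).card * n ≤ ∑ x ∈ C \ Gd, 10 * (bad x).card := by
      rw [← smul_eq_mul]
      apply Finset.card_nsmul_le_sum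
      intro x hx
      simp only [Gd, Finset.mem_sdiff, Finset.mem_filter, not_and, not_le] at hx
      exact (hx.2 hx.1).le
    have h2 : ∑ x ∈ C \ Gd, (bad x).card ≤ β := by
      have : ∑ x ∈ C \ Gd, (bad x).card ≤ ∑ x ∈ C, (bad x).card :=
        Finset.sum_le_sum_of_subset Finset.sdiff_subset
      refine this.trans ?_
      rw [hβ, Bset, Finset.card_filter, Finset.sum_product]
      apply Finset.sum_le_sum
      intro x _
      simp only [bad]
      rw [Finset.card_filter]
    rw [← Finset.mul_sum] at h1
    have h3 : (C \ Gd).card + Gd.card = n :=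
      Finset.card_sdiff_add_card_eq_card (Finset.filter_subset _ _)
    by_contra hlt
    push Not at hlt
    have h4 : n ≤ (C \ Gd).card + 2 * t := by omega
    have h5 : n * n ≤ ((C \ Gd).card + 2 * t) * n := Nat.mul_le_mul_right _ h4
    nlinarith
  · intro Z hZ a ha b hb haZ hbZ
    have ha' : 10 * (bad a).card ≤ n := (Finset.mem_filter.1 ha).2
    have hb' : 10 * (bad b).card ≤ n := (Finset.mem_filter.1 hb).2
    have hsub : C ×ˢ C ⊆ O2set p q C Z a b ∪ ((Z ×ˢ C) ∪ ((C ×ˢ Z) ∪ (C.diag ∪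
        ((bad a ×ˢ C) ∪ ((C ×ˢ bad b) ∪ Bset p q C))))) := by
      rintro ⟨r, r'⟩ hr
      obtain ⟨hr1, hr2⟩ := Finset.mem_product.1 hr
      simp only at hr1 hr2
      by_cases c1 : r ∈ Z
      · simp [c1, hr2]
      by_cases c2 : r' ∈ Z
      · simp [c2, hr1]
      by_cases c3 : r = r'
      · simp [c3, hr2]
      by_cases c4 : p a r = q
      · by_cases c5 : p r' b = q
        · by_cases c6 : p r r' = q
          · simp [O2set, c1, c2, c3, c4, c5, c6, hr1, hr2]
          · simp [Bset, c3, c6, hr1, hr2]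
        · have : b ≠ r' := fun h => c2 (h ▸ hbZ)
          have c5' : p b r' ≠ q := by rwa [hp]
          simp [bad, hr1, hr2, this, c5']
      · have : a ≠ r := fun h => c1 (h ▸ haZ)
        simp [bad, hr1, hr2, this, c4]
    have hcard := Finset.card_le_card hsub
    have d0 := Finset.card_union_le (O2set p q C Z a b) ((Z ×ˢ C) ∪ ((C ×ˢ Z) ∪ (C.diag ∪
        ((bad a ×ˢ C) ∪ ((C ×ˢ bad b) ∪ Bset p q C)))))
    have d1 := Finset.card_union_le (Z ×ˢ C) ((C ×ˢ Z) ∪ (C.diag ∪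
        ((bad a ×ˢ C) ∪ ((C ×ˢ bad b) ∪ Bset p q C))))
    have d2 := Finset.card_union_le (C ×ˢ Z) (C.diag ∪
        ((bad a ×ˢ C) ∪ ((C ×ˢ bad b) ∪ Bset p q C)))
    have d3 := Finset.card_union_le (C.diag)
        ((bad a ×ˢ C) ∪ ((C ×ˢ bad b) ∪ Bset p q C))
    have d4 := Finset.card_union_le (bad a ×ˢ C) ((C ×ˢ bad b) ∪ Bset p q C)
    have d5 := Finset.card_union_le (C ×ˢ bad b) (Bset p q C)
    simp only [Finset.card_product, Finset.diag_card] at hcard d0 d1 d2 d3 d4 d5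
    rw [mul_comm _ Z.card] at d2
    rw [mul_comm _ (bad b).card] at d5
    simp only [← hn, ← hβ] at hcard d0 d1 d2 d3 d4 d5
    have e1 := Nat.mul_le_mul_right n hZ
    have e2 := Nat.mul_le_mul_right n ha'
    have e3 := Nat.mul_le_mul_right n hb'
    have key : 10 * (n * n) ≤ 10 * (O2set p q C Z a b).card + 40 * (t * n) + 10 * n + 2 * (n * n)
      + 10 * β := by nlinarith
    have hN2 : 14 * t * N ≤ 14 * t * (4 * n + 2) := Nat.mul_le_mul_left _ hC
    have k1 : 24500 * (t * n) + 1102517 * n ≤ n * n := by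
      have := Nat.mul_le_mul_right n hnt
      nlinarith
    have k2 : 24500 * (t * t) + 1102517 * t ≤ t * n := by
      have := Nat.mul_le_mul_left t hnt
      nlinarith
    have hβ3 : 1600 * β < 16 * (n * n) + 16 * n + 4 :=
      hβ2.trans_le (le_of_eq (by ring))
    have hN3 : 14 * t * N ≤ 56 * (t * n) + 28 * t := hN2.trans (le_of_eq (by ring))
    clear hN2 hβ2 e1 e2 e3 d0 d1 d2 d3 d4 d5 hcard hB
    generalize n * n = nn at *
    generalize t * n = tn at *
    generalize t * t = tt at *
    generalize 14 * t * N = tN at *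
    omega

end Comb

section Main
open Classical

lemma max_cut {V : Type*} [Fintype V] (G : SimpleGraph V) :
    ∃ col : V → Bool, ∀ X : Finset V,
      (Finset.univ.filter (fun e : V × V =>
        (G.Adj e.1 e.2 ∧ col e.1 = col e.2) ∧ e.1 ∈ X ∧ e.2 ∉ X)).card ≤
      (Finset.univ.filter (fun e : V × V =>
        (G.Adj e.1 e.2 ∧ col e.1 ≠ col e.2) ∧ e.1 ∈ X ∧ e.2 ∉ X)).card := by
  obtain ⟨col, _, hmax⟩ := Finset.exists_max_image (Finset.univ : Finset (V → Bool))
    (fun col => ∑ e : V × V, if G.Adj e.1 e.2 ∧ col e.1 ≠ col e.2 then 1 else 0)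
    ⟨fun _ => true, by simp⟩
  refine ⟨col, fun X => ?_⟩
  have h := hmax (fun v => if v ∈ X then !(col v) else col v) (by simp)
  have s1 : (∑ e : V × V, if (G.Adj e.2 e.1 ∧ col e.2 ≠ col e.1) ∧ e.2 ∈ X ∧ e.1 ∉ X then 1 else 0) =
      ∑ e : V × V, if (G.Adj e.1 e.2 ∧ col e.1 ≠ col e.2) ∧ e.1 ∈ X ∧ e.2 ∉ X then 1 else 0 :=
    Equiv.sum_comp (Equiv.prodComm V V) (fun e : V × V =>
      if (G.Adj e.1 e.2 ∧ col e.1 ≠ col e.2) ∧ e.1 ∈ X ∧ e.2 ∉ X then 1 else 0)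
  have s2 : (∑ e : V × V, if (G.Adj e.2 e.1 ∧ col e.2 = col e.1) ∧ e.2 ∈ X ∧ e.1 ∉ X then 1 else 0) =
      ∑ e : V × V, if (G.Adj e.1 e.2 ∧ col e.1 = col e.2) ∧ e.1 ∈ X ∧ e.2 ∉ X then 1 else 0 :=
    Equiv.sum_comp (Equiv.prodComm V V) (fun e : V × V =>
      if (G.Adj e.1 e.2 ∧ col e.1 = col e.2) ∧ e.1 ∈ X ∧ e.2 ∉ X then 1 else 0)
  have key : (∑ e : V × V, if G.Adj e.1 e.2 ∧ (if e.1 ∈ X then !(col e.1) else col e.1) ≠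
        (if e.2 ∈ X then !(col e.2) else col e.2) then 1 else 0) +
      ((∑ e : V × V, if (G.Adj e.1 e.2 ∧ col e.1 ≠ col e.2) ∧ e.1 ∈ X ∧ e.2 ∉ X then 1 else 0) +
      (∑ e : V × V, if (G.Adj e.2 e.1 ∧ col e.2 ≠ col e.1) ∧ e.2 ∈ X ∧ e.1 ∉ X then 1 else 0)) =
      (∑ e : V × V, if G.Adj e.1 e.2 ∧ col e.1 ≠ col e.2 then 1 else 0) +
      ((∑ e : V × V, if (G.Adj e.1 e.2 ∧ col e.1 = col e.2) ∧ e.1 ∈ X ∧ e.2 ∉ X then 1 else 0) +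
      (∑ e : V × V, if (G.Adj e.2 e.1 ∧ col e.2 = col e.1) ∧ e.2 ∈ X ∧ e.1 ∉ X then 1 else 0)) := by
    simp only [← Finset.sum_add_distrib]
    apply Finset.sum_congr rfl
    rintro ⟨c, d⟩ _
    simp only [G.adj_comm d c]
    by_cases h1 : G.Adj c d <;> by_cases h2 : c ∈ X <;> by_cases h3 : d ∈ X <;>
      cases col c <;> cases col d <;> simp [h1, h2, h3]
  rw [Finset.card_filter, Finset.card_filter]
  rw [s1, s2] at key
  omega

lemma mk_pattern {V : Type*} (G : SimpleGraph V) (t : ℕ) (σ : Sym2 (Fin t) → ZMod 2)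
    (ψ : Fin t ↪ V) (K : ∀ i j : Fin t, i < j → G.Walk (ψ i) (ψ j))
    (hK : ∀ i j h, (K i j h).IsTrail)
    (hd : ∀ i j k l (h : i < j) (h' : k < l), (i, j) ≠ (k, l) →
      List.Disjoint (K i j h).edges (K k l h').edges)
    (hp : ∀ i j h, ((K i j h).length : ZMod 2) = σ s(i, j)) :
    HasParityPatternImmersion G t σ := by
  let tr : ∀ u v : Fin t, u ≠ v → G.Walk (ψ u) (ψ v) := fun u v h =>
    if h' : u < v then K u v h' else (K v u (lt_of_le_of_ne (not_lt.1 h') h.symm)).reverse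
  have htr : ∀ u v h, ∃ i j, ∃ h' : i < j, s(i, j) = s(u, v) ∧
      (∀ e, e ∈ (tr u v h).edges ↔ e ∈ (K i j h').edges) ∧ (tr u v h).IsTrail ∧
      (tr u v h).length = (K i j h').length := by
    intro u v h
    by_cases h' : u < v
    · exact ⟨u, v, h', rfl, by simp [tr, h'], by simp [tr, h', hK], by simp [tr, h']⟩
    · exact ⟨v, u, lt_of_le_of_ne (not_lt.1 h') h.symm, Sym2.eq_swap, by simp [tr, h'],
        by simp [tr, h', hK], by simp [tr, h']⟩
  refine ⟨⟨ψ, fun u v h => tr u v h.ne, ?_, ?_, ?_⟩, ?_⟩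
  · intro u v h
    obtain ⟨_, _, _, _, _, h3, _⟩ := htr u v h.ne
    exact h3
  · intro u v h
    rcases lt_or_gt_of_ne h.ne with h' | h'
    · simp [tr, h', not_lt.2 h'.le]
    · simp [tr, h', not_lt.2 h'.le]
  · intro u v a b h₁ h₂ hne
    obtain ⟨i, j, hij, e1, e2, _⟩ := htr u v h₁.ne
    obtain ⟨k, l, hkl, f1, f2, _⟩ := htr a b h₂.ne
    intro e he he'
    refine hd i j k l hij hkl ?_ ((e2 e).1 he) ((f2 e).1 he')
    intro heq
    apply hne
    rw [← e1, ← f1]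
    simp only [Prod.mk.injEq] at heq
    rw [heq.1, heq.2]
  · intro u v h
    obtain ⟨i, j, hij, e1, _, _, e4⟩ := htr u v h.ne
    change ((tr u v h.ne).length : ZMod 2) = _
    rw [e4, hp, e1]

/-- index pairs -/
abbrev Prs (t : ℕ) := {ij : Fin t × Fin t // ij.1 < ij.2}

lemma Prs_card (t : ℕ) : Fintype.card (Prs t) ≤ t * t :=
  (Fintype.card_subtype_le _).trans (by simp)

lemma Prs_fst (t : ℕ) (i : Fin t) :
    (Finset.univ.filter (fun z : Prs t => z.1.1 = i)).card ≤ t := by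
  have : (Finset.univ.filter (fun z : Prs t => z.1.1 = i)).card ≤
      (Finset.univ : Finset (Fin t)).card := by
    apply Finset.card_le_card_of_injOn (fun z => z.1.2) (by intro; simp)
    intro x hx y hy hxy
    simp at hx hy hxy
    exact Subtype.ext (Prod.ext (hx.trans hy.symm) hxy)
  simpa using this

lemma Prs_snd (t : ℕ) (i : Fin t) :
    (Finset.univ.filter (fun z : Prs t => z.1.2 = i)).card ≤ t := by
  have : (Finset.univ.filter (fun z : Prs t => z.1.2 = i)).card ≤
      (Finset.univ : Finset (Fin t)).card := by
    apply Finset.card_le_card_of_injOn (fun z => z.1.1) (by intro; simp)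
    intro x hx y hy hxy
    simp at hx hy hxy
    exact Subtype.ext (Prod.ext hxy (hx.trans hy.symm))
  simpa using this

lemma assembly {V W : Type*} [Fintype W] (G : SimpleGraph V) (t : ℕ) (ht : 1 ≤ t)
    (σ : Sym2 (Fin t) → ZMod 2) (φ : W ↪ V) (P : ∀ x y : W, x ≠ y → G.Walk (φ x) (φ y))
    (hPt : ∀ x y h, (P x y h).IsTrail)
    (hPd : ∀ x y z w h h', s(x, y) ≠ s(z, w) → List.Disjoint (P x y h).edges (P z w h').edges)
    (p : W → W → ZMod 2) (hp : ∀ x y h, ((P x y h).length : ZMod 2) = p x y)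
    (τ : Fin t ↪ W) (a : Prs t → W) (R : ∀ i : Prs t, G.Walk (φ (τ i.1.1)) (φ (a i)))
    (hRt : ∀ i, (R i).IsTrail) (hRd : ∀ i j, i ≠ j → List.Disjoint (R i).edges (R j).edges)
    (Z : Finset W)
    (hRP : ∀ i x y h, (x ∉ Z ∨ y ∉ Z) → List.Disjoint (R i).edges (P x y h).edges)
    (O : Prs t → Finset (W × W))
    (hO : ∀ i, ∀ z ∈ O i, z.1 ∉ Z ∧ z.2 ∉ Z ∧ z.1 ≠ z.2 ∧ z.1 ≠ a i ∧ z.1 ≠ τ i.1.2 ∧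
      z.2 ≠ a i ∧ z.2 ≠ τ i.1.2 ∧
      ((R i).length : ZMod 2) + p (a i) z.1 + p z.1 z.2 + p z.2 (τ i.1.2) = σ s(i.1.1, i.1.2))
    (hOc : ∀ i, 14 * t * Fintype.card W + 6 * (t * t) < (O i).card)
    (ha : ∀ x, (Finset.univ.filter (fun i => a i = x)).card ≤ t) :
    HasParityPatternImmersion G t σ := by
  obtain ⟨r, r', h1, h2⟩ := routing t ht a (fun i : Prs t => τ i.1.2) O (Prs_card t) ha (by
    intro x
    by_cases hx : ∃ m, τ m = x
    · obtain ⟨m, rfl⟩ := hx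
      simpa using Prs_snd t m
    · push Not at hx
      rw [Finset.filter_false_of_mem (fun i _ => hx _)]
      simp) hOc
  have hr := fun i => hO i _ (h1 i)
  simp only at hr
  let T : ∀ i : Prs t, G.Walk (φ (a i)) (φ (τ i.1.2)) := fun i =>
    (P (a i) (r i) (hr i).2.2.2.1.symm).append
      ((P (r i) (r' i) (hr i).2.2.1).append (P (r' i) (τ i.1.2) (hr i).2.2.2.2.2.2.1))
  have hTe : ∀ i e, e ∈ (T i).edges → ∃ x y h, s(x, y) ∈ redg a (fun i : Prs t => τ i.1.2) r r' i ∧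
      (x ∉ Z ∨ y ∉ Z) ∧ e ∈ (P x y h).edges := by
    intro i e he
    simp only [T, Walk.edges_append, List.mem_append] at he
    rcases he with he | he | he
    · exact ⟨_, _, _, by simp [redg], Or.inr (hr i).1, he⟩
    · exact ⟨_, _, _, by simp [redg], Or.inr (hr i).2.1, he⟩
    · exact ⟨_, _, _, by simp [redg], Or.inl (hr i).2.1, he⟩
  have hTt : ∀ i, (T i).IsTrail := by
    intro i
    obtain ⟨_, _, n1, n2, n3, n4, n5, _⟩ := hr i
    have app : ∀ {u v w : V} (p : G.Walk u v) (q : G.Walk v w), p.IsTrail → q.IsTrail →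
        List.Disjoint p.edges q.edges → (p.append q).IsTrail := by
      intro u v w p q hp hq hpq
      rw [Walk.isTrail_def, Walk.edges_append]
      exact List.Nodup.append hp.edges_nodup hq.edges_nodup hpq
    refine app _ _ (hPt _ _ _) (app _ _ (hPt _ _ _) (hPt _ _ _) ?_) ?_
    · apply hPd
      rw [ne_eq, Sym2.eq_iff]
      rintro (⟨h, _⟩ | ⟨h, _⟩)
      · exact n1 h
      · exact n3 h
    · rw [Walk.edges_append, List.disjoint_append_right]
      constructor
      · apply hPd
        rw [ne_eq, Sym2.eq_iff]
        rintro (⟨h, _⟩ | ⟨h, _⟩)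
        · exact n2 h.symm
        · exact n4 h.symm
      · apply hPd
        rw [ne_eq, Sym2.eq_iff]
        rintro (⟨h, _⟩ | ⟨_, h⟩)
        · exact n4 h.symm
        · exact n1 h
  have hRT : ∀ i j, List.Disjoint (R i).edges (T j).edges := by
    intro i j e he he'
    obtain ⟨x, y, h, _, hz, he'⟩ := hTe j e he'
    exact hRP i x y h hz he he'
  have hTT : ∀ i j, i ≠ j → List.Disjoint (T i).edges (T j).edges := by
    intro i j hij e he he'
    obtain ⟨x, y, h, hx, _, he⟩ := hTe i e he
    obtain ⟨x', y', h', hx', _, he'⟩ := hTe j e he'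
    refine hPd x y x' y' h h' ?_ he he'
    intro heq
    exact Finset.disjoint_left.1 (h2 i j hij) hx (heq ▸ hx')
  have hA1 : ∀ z : Prs t, ((R z).append (T z)).IsTrail := by
    intro z
    rw [Walk.isTrail_def, Walk.edges_append]
    exact List.Nodup.append (hRt _).edges_nodup (hTt _).edges_nodup (hRT _ _)
  have hA2 : ∀ z z' : Prs t, z ≠ z' →
      List.Disjoint ((R z).append (T z)).edges ((R z').append (T z')).edges := by
    intro z z' hne'
    rw [Walk.edges_append (R z), Walk.edges_append (R z'), List.disjoint_append_right,
      List.disjoint_append_left, List.disjoint_append_left]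
    exact ⟨⟨hRd _ _ hne', (hRT _ _).symm⟩, hRT _ _, hTT _ _ hne'⟩
  have hA3 : ∀ z : Prs t, (((R z).append (T z)).length : ZMod 2) = σ s(z.1.1, z.1.2) := by
    intro z
    have := (hr z).2.2.2.2.2.2.2
    rw [← this]
    simp only [T, Walk.length_append, Nat.cast_add, hp]
    ring
  exact mk_pattern G t σ (τ.trans φ) (fun i j h => (R ⟨(i, j), h⟩).append (T ⟨(i, j), h⟩))
    (fun i j h => hA1 ⟨(i, j), h⟩)
    (fun i j k l h h' hne => hA2 ⟨(i, j), h⟩ ⟨(k, l), h'⟩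
      (fun heq => hne (congrArg Subtype.val heq)))
    (fun i j h => hA3 ⟨(i, j), h⟩)

lemma bip_len {V : Type*} (G : SimpleGraph V) (col : V → Bool)
    (hcol : ∀ x y, G.Adj x y → col x ≠ col y) {u v : V} (w : G.Walk u v) :
    Even w.length ↔ col u = col v := by
  induction w with
  | nil => simp
  | cons h q ih =>
    have := hcol _ _ h
    rw [Walk.length_cons, Nat.even_add_one, ih]
    revert this
    generalize col _ = x
    generalize col _ = y
    generalize col _ = z
    revert x y z
    decide

lemma mono_walk {V : Type*} (G : SimpleGraph V) (col : V → Bool) {u v : V} (w : G.Walk u v)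
    (hm : ∀ c d, s(c, d) ∈ w.edges → col c = col d) : col u = col v := by
  induction w with
  | nil => rfl
  | @cons u v w h q ih =>
    rw [hm u v (by simp), ih (fun c d hcd => hm c d (by simp [hcd]))]

lemma odd_tokens {V W : Type*} [Fintype V] (G : SimpleGraph V) (t : ℕ) (ht : 1 ≤ t)
    (col : V → Bool)
    (hcut : ∀ X : Finset V,
      (Finset.univ.filter (fun e : V × V =>
        (G.Adj e.1 e.2 ∧ col e.1 = col e.2) ∧ e.1 ∈ X ∧ e.2 ∉ X)).card ≤
      (Finset.univ.filter (fun e : V × V =>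
        (G.Adj e.1 e.2 ∧ col e.1 ≠ col e.2) ∧ e.1 ∈ X ∧ e.2 ∉ X)).card)
    (φ : W ↪ V) (P : ∀ x y : W, x ≠ y → G.Walk (φ x) (φ y))
    (hPt : ∀ x y h, (P x y h).IsTrail)
    (hPd : ∀ x y z w h h', s(x, y) ≠ s(z, w) → List.Disjoint (P x y h).edges (P z w h').edges)
    (hPm : ∀ x y h c d, s(c, d) ∈ (P x y h).edges → col c = col d)
    (τ β : Fin t ↪ W) (hτβ : ∀ i j, τ i ≠ β j) :
    ∃ (k : Fin t × Fin t → Fin t) (R : ∀ z : Fin t × Fin t, G.Walk (φ (τ z.1)) (φ (β (k z)))),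
      (∀ z, (R z).IsTrail) ∧ (∀ z, ((R z).length : ZMod 2) = 1) ∧
      (∀ z z', z ≠ z' → List.Disjoint (R z).edges (R z').edges) ∧
      (∀ z x y h, (∀ i j, s(x, y) ≠ s(τ i, β j)) → List.Disjoint (R z).edges (P x y h).edges) ∧
      ∀ m, (Finset.univ.filter (fun z => k z = m)).card ≤ t := by
  have hne : ∀ z : Fin t × Fin t, φ (τ z.1) ≠ φ (β z.2) := fun z h => hτβ _ _ (φ.injective h)
  have hsne : ∀ z z' : Fin t × Fin t, z ≠ z' → s(τ z.1, β z.2) ≠ s(τ z'.1, β z'.2) := by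
    intro z z' hz heq
    rw [Sym2.eq_iff] at heq
    rcases heq with ⟨h1, h2⟩ | ⟨h1, _⟩
    · exact hz (Prod.ext (τ.injective h1) (β.injective h2))
    · exact hτβ _ _ h1
  choose y hy q hq using fun z : Fin t × Fin t =>
    Walk.exists_eq_cons_of_ne (hne z) (P (τ z.1) (β z.2) (hτβ _ _))
  have hfirst : ∀ z, s(φ (τ z.1), y z) ∈ (P (τ z.1) (β z.2) (hτβ _ _)).edges := by
    intro z; rw [hq]; simp
  have hqsub : ∀ z e, e ∈ (q z).edges → e ∈ (P (τ z.1) (β z.2) (hτβ _ _)).edges := by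
    intro z e he; rw [hq]; simp [he]
  let Fg : SimpleGraph V :=
    { Adj := fun c d => G.Adj c d ∧ col c ≠ col d
      symm := ⟨fun c d h => ⟨h.1.symm, h.2.symm⟩⟩
      loopless := ⟨fun c h => h.2 rfl⟩ }
  let cap : V → ℕ := fun x => if ∃ m, φ (β m) = x then t else 0
  obtain ⟨e, Q, hQt, hQd, hQc⟩ := flow_graph Fg cap y (by
    intro X
    have hsplit : (Finset.univ.filter (fun z => y z ∈ X)) ⊆
        (Finset.univ.filter (fun z => y z ∈ X ∧ φ (β z.2) ∉ X)) ∪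
        (Finset.univ.filter (fun z : Fin t × Fin t => φ (β z.2) ∈ X)) := by
      intro z hz
      by_cases hb : φ (β z.2) ∈ X <;> simp_all
    refine (Finset.card_le_card hsplit).trans ((Finset.card_union_le _ _).trans ?_)
    apply Nat.add_le_add
    · refine le_trans (le_trans ?_ (hcut X)) (Finset.card_le_card (fun z hz => by
        exact (@Finset.mem_filter _ _ (_) _ _).2 ⟨Finset.mem_univ _,
          ((@Finset.mem_filter _ _ (_) _ _).1 hz).2⟩))
      have hd : ∀ z : Fin t × Fin t, ∃ d : V × V, (y z ∈ X ∧ φ (β z.2) ∉ X) →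
          ((G.Adj d.1 d.2 ∧ col d.1 = col d.2) ∧ d.1 ∈ X ∧ d.2 ∉ X) ∧
          s(d.1, d.2) ∈ (P (τ z.1) (β z.2) (hτβ _ _)).edges := by
        intro z
        by_cases hz : y z ∈ X ∧ φ (β z.2) ∉ X
        · obtain ⟨d, hd, h1, h2⟩ := (q z).exists_boundary_dart (X : Set V) (by simpa using hz.1)
            (by simpa using hz.2)
          have hde : s(d.fst, d.snd) ∈ (P (τ z.1) (β z.2) (hτβ _ _)).edges :=
            hqsub z _ (List.mem_map.2 ⟨d, hd, rfl⟩)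
          exact ⟨(d.fst, d.snd), fun _ => ⟨⟨⟨d.adj, hPm _ _ _ _ _ hde⟩, by simpa using h1,
            by simpa using h2⟩, hde⟩⟩
        · exact ⟨(y z, y z), fun h => absurd h hz⟩
      choose d hd using hd
      apply Finset.card_le_card_of_injOn d
      · intro z hz
        have hz' : y z ∈ X ∧ φ (β z.2) ∉ X := by simpa using hz
        have := (hd z hz').1
        simpa using this
      · intro z hz z' hz' hzz
        have h1 := (hd z (by simpa using hz)).2
        have h2 := (hd z' (by simpa using hz')).2
        by_contra hne'
        rw [hzz] at h1
        exact hPd _ _ _ _ _ _ (hsne z z' hne') h1 h2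
    · rw [Finset.card_eq_sum_card_fiberwise (f := fun z : Fin t × Fin t => φ (β z.2)) (t := X)
        (by intro z hz; simpa using hz)]
      apply Finset.sum_le_sum
      intro x _
      by_cases hx : ∃ m, φ (β m) = x
      · simp only [cap, if_pos hx]
        obtain ⟨m, rfl⟩ := hx
        have : (Finset.filter (fun z : Fin t × Fin t => φ (β z.2) = φ (β m))
            (Finset.univ.filter (fun z : Fin t × Fin t => φ (β z.2) ∈ X))).card ≤
            (Finset.univ : Finset (Fin t)).card := by
          apply Finset.card_le_card_of_injOn (fun z => z.1) (by intro; simp)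
          intro z hz z' hz' hzz
          simp at hz hz' hzz
          exact Prod.ext hzz (hz.2.trans hz'.2.symm)
        simpa using this
      · rw [Finset.filter_false_of_mem]
        · simp
        · intro z _ h
          exact hx ⟨_, h⟩)
  have hek : ∀ z, ∃ m, φ (β m) = e z := by
    intro z
    by_contra hcon
    have := hQc (e z)
    simp only [cap, if_neg hcon] at this
    have h0 := Finset.card_eq_zero.1 (Nat.le_zero.1 this)
    have : z ∈ Finset.univ.filter (fun i => e i = e z) := by simp
    rw [h0] at this
    simp at this
  choose k hk using hek
  have hFG : Fg ≤ G := fun c d h => h.1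
  have hQF : ∀ z c d, s(c, d) ∈ (Q z).edges → col c ≠ col d := fun z c d h =>
    ((Q z).adj_of_mem_edges h).2
  have hQG : ∀ z, ∀ e ∈ (Q z).edges, e ∈ G.edgeSet := fun z e he =>
    edgeSet_mono hFG ((Q z).edges_subset_edgeSet he)
  let Q' : ∀ z, G.Walk (y z) (φ (β (k z))) := fun z =>
    ((Q z).transfer G (hQG z)).copy rfl (hk z).symm
  have hQ'e : ∀ z, (Q' z).edges = (Q z).edges := by
    intro z; simp [Q', Walk.edges_copy, Walk.edges_transfer]
  have hQ'l : ∀ z, (Q' z).length = (Q z).length := by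
    intro z; simp [Q']
  have hRe : ∀ z e, e ∈ (Walk.cons (hy z) (Q' z)).edges → e = s(φ (τ z.1), y z) ∨ e ∈ (Q z).edges := by
    intro z e he
    simpa [hQ'e] using he
  have hcross : ∀ z x y h e, e ∈ (Q z).edges → e ∈ (P x y h).edges → False := by
    intro z x y h e
    induction e with
    | _ c d => exact fun h1 h2 => hQF z c d h1 (hPm _ _ _ _ _ h2)
  refine ⟨k, fun z => Walk.cons (hy z) (Q' z), ?_, ?_, ?_, ?_, ?_⟩
  · intro z
    rw [Walk.isTrail_def, Walk.edges_cons, List.nodup_cons, hQ'e]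
    exact ⟨fun h => hcross z _ _ _ _ h (hfirst z), (hQt z).edges_nodup⟩
  · intro z
    have h1 : col (φ (τ z.1)) = col (y z) := hPm _ _ _ _ _ (hfirst z)
    have h2 : col (φ (τ z.1)) = col (φ (β (k z))) :=
      mono_walk G col (P (τ z.1) (β (k z)) (hτβ _ _)) (hPm _ _ _)
    have h3 : Even (Q z).length := by
      rw [bip_len Fg col (fun _ _ h => h.2), ← hk z, ← h1, h2]
    rw [Walk.length_cons, hQ'l]
    push_cast
    rw [(ZMod.natCast_eq_zero_iff_even).2 h3]
    simp
  · intro z z' hz e he he'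
    rcases hRe z e he with rfl | he
    · rcases hRe z' _ he' with h | he'
      · have h1 := hfirst z
        rw [h] at h1
        exact hPd _ _ _ _ _ _ (hsne z z' hz) h1 (hfirst z')
      · exact hcross z' _ _ _ _ he' (hfirst z)
    · rcases hRe z' e he' with rfl | he'
      · exact hcross z _ _ _ _ he (hfirst z')
      · exact hQd z z' hz he he'
  · intro z x y' h hxy e he he'
    rcases hRe z e he with rfl | he
    · exact hPd _ _ _ _ _ _ (hxy z.1 z.2).symm (hfirst z) he'
    · exact hcross z _ _ _ _ he he'
  · intro m
    have := hQc (φ (β m))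
    simp only [cap, if_pos (⟨m, rfl⟩ : ∃ m', φ (β m') = φ (β m))] at this
    refine le_trans (Finset.card_le_card ?_) this
    intro z hz
    simp at hz
    simp [← hk z, hz]

lemma main_case {V W : Type*} [Fintype V] [Fintype W] (G : SimpleGraph V) (t : ℕ) (ht : 1 ≤ t)
    (σ : Sym2 (Fin t) → ZMod 2) (hN : 98000 * t + 4410071 ≤ Fintype.card W)
    (col : V → Bool)
    (hcut : ∀ X : Finset V,
      (Finset.univ.filter (fun e : V × V =>
        (G.Adj e.1 e.2 ∧ col e.1 = col e.2) ∧ e.1 ∈ X ∧ e.2 ∉ X)).card ≤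
      (Finset.univ.filter (fun e : V × V =>
        (G.Adj e.1 e.2 ∧ col e.1 ≠ col e.2) ∧ e.1 ∈ X ∧ e.2 ∉ X)).card)
    (φ : W ↪ V) (P : ∀ x y : W, x ≠ y → G.Walk (φ x) (φ y))
    (hPt : ∀ x y h, (P x y h).IsTrail)
    (hPs : ∀ x y h, (P x y h).length = (P y x h.symm).length)
    (hPd : ∀ x y z w h h', s(x, y) ≠ s(z, w) → List.Disjoint (P x y h).edges (P z w h').edges)
    (hPm : ∀ x y h c d, s(c, d) ∈ (P x y h).edges → col c = col d) :
    HasParityPatternImmersion G t σ := by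
  let p : W → W → ZMod 2 := fun x y => if h : x ≠ y then ((P x y h).length : ZMod 2) else 0
  have hp : ∀ x y h, ((P x y h).length : ZMod 2) = p x y := by
    intro x y h; simp only [p, dif_pos h]
  have hps : ∀ x y, p x y = p y x := by
    intro x y
    by_cases h : x = y
    · rw [h]
    · rw [← hp x y h, ← hp y x (Ne.symm h), hPs]
  have hbig : 1600 * (14 * t * Fintype.card W + 6 * (t * t)) < Fintype.card W ^ 2 := by
    generalize Fintype.card W = N at hN
    have h1 := Nat.mul_le_mul_right N hN
    have h2 := Nat.mul_le_mul_left t hN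
    nlinarith
  by_cases hgood : ∀ u v, u ≠ v → ∀ b, Fintype.card W ^ 2 ≤ 1600 * (Oset p u v b).card
  · -- all pairs have many routes of both parities
    obtain ⟨τ⟩ : Nonempty (Fin t ↪ W) := by
      apply Function.Embedding.nonempty_of_card_le
      simp; omega
    refine assembly G t ht σ φ P hPt hPd p hp τ (fun i => τ i.1.1) (fun i => Walk.nil)
      (by simp) (by simp) ∅ (by simp)
      (fun i => Oset p (τ i.1.1) (τ i.1.2) (σ s(i.1.1, i.1.2))) ?_ ?_ ?_
    · intro i z hz
      simp only [Oset, Finset.mem_filter, Finset.mem_univ, true_and] at hz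
      obtain ⟨h1, h2, h3, h4, h5, h6⟩ := hz
      exact ⟨by simp, by simp, h5, h1, h2, h3, h4, by simpa using h6⟩
    · intro i
      have := hgood (τ i.1.1) (τ i.1.2) (fun h => i.2.ne (τ.injective h)) (σ s(i.1.1, i.1.2))
      omega
    · intro x
      by_cases hx : ∃ m, τ m = x
      · obtain ⟨m, rfl⟩ := hx
        simpa using Prs_fst t m
      · push Not at hx
        rw [Finset.filter_false_of_mem (fun i _ => hx _)]
        simp
  · push Not at hgood
    obtain ⟨u, v, _, b, hb⟩ := hgood
    obtain ⟨q, C, hC, hB⟩ := near_const p u v b hb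
    obtain ⟨Gd, hGd, hroute⟩ := good_vertices t hN p hps q C hC hB
    obtain ⟨f⟩ : Nonempty (Fin t ⊕ Fin t ↪ Gd) := by
      apply Function.Embedding.nonempty_of_card_le
      simp; omega
    let τ : Fin t ↪ W := ⟨fun i => f (Sum.inl i), fun i j h => by
      simpa using f.injective (Subtype.ext h)⟩
    let β : Fin t ↪ W := ⟨fun i => f (Sum.inr i), fun i j h => by
      simpa using f.injective (Subtype.ext h)⟩
    have hτβ : ∀ i j, τ i ≠ β j := by
      intro i j h
      simpa using f.injective (Subtype.ext h)
    have hτG : ∀ i, τ i ∈ Gd := fun i => (f (Sum.inl i)).2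
    have hβG : ∀ i, β i ∈ Gd := fun i => (f (Sum.inr i)).2
    let Z : Finset W := Finset.univ.image τ ∪ Finset.univ.image β
    have hτZ : ∀ i, τ i ∈ Z := fun i => by simp [Z]
    have hβZ : ∀ i, β i ∈ Z := fun i => by simp [Z]
    have hZ : Z.card ≤ 2 * t := by
      refine (Finset.card_union_le _ _).trans ?_
      have h1 := Finset.card_image_le (s := (Finset.univ : Finset (Fin t))) (f := τ)
      have h2 := Finset.card_image_le (s := (Finset.univ : Finset (Fin t))) (f := β)
      simp only [Finset.card_univ, Fintype.card_fin] at h1 h2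
      omega
    obtain ⟨k, R, hRt, hRl, hRd, hRP, hRc⟩ := odd_tokens G t ht col hcut φ P hPt hPd hPm τ β hτβ
    have hex : ∀ i : Prs t, ∃ (a : W) (R' : G.Walk (φ (τ i.1.1)) (φ a)), R'.IsTrail ∧
        (R'.length : ZMod 2) + q + q + q = σ s(i.1.1, i.1.2) ∧
        (∀ e ∈ R'.edges, e ∈ (R i.1).edges) ∧ (a = τ i.1.1 ∨ a = β (k i.1)) := by
      intro i
      have h2 : ∀ x y : ZMod 2, x ≠ y → 1 + y + y + y = x := by decide
      have h3 : ∀ y : ZMod 2, 0 + y + y + y = y := by decide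
      by_cases hs : σ s(i.1.1, i.1.2) = q
      · refine ⟨τ i.1.1, Walk.nil, by simp, ?_, by simp, Or.inl rfl⟩
        rw [hs]; simpa using h3 q
      · refine ⟨β (k i.1), R i.1, hRt _, ?_, fun e he => he, Or.inr rfl⟩
        rw [hRl]
        exact h2 _ _ hs
    choose a R' hR't hR'l hR'e ha using hex
    have haG : ∀ i, a i ∈ Gd ∧ a i ∈ Z := by
      intro i
      rcases ha i with h | h
      · rw [h]; exact ⟨hτG _, hτZ _⟩
      · rw [h]; exact ⟨hβG _, hβZ _⟩
    refine assembly G t ht σ φ P hPt hPd p hp τ a R' hR't ?_ Z ?_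
      (fun i => O2set p q C Z (a i) (τ i.1.2)) ?_ ?_ ?_
    · intro i j hij e he he'
      exact hRd i.1 j.1 (fun h => hij (Subtype.ext h)) (hR'e i e he) (hR'e j e he')
    · intro i x y h hxy e he he'
      refine hRP i.1 x y h ?_ (hR'e i e he) he'
      intro i' j' heq
      rw [Sym2.eq_iff] at heq
      rcases heq with ⟨rfl, rfl⟩ | ⟨rfl, rfl⟩
      · rcases hxy with h | h
        · exact h (hτZ _)
        · exact h (hβZ _)
      · rcases hxy with h | h
        · exact h (hβZ _)
        · exact h (hτZ _)
    · intro i z hz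
      simp only [O2set, Finset.mem_filter] at hz
      obtain ⟨_, h1, h2, h3, h4, h5, h6⟩ := hz
      have na : ∀ x, x ∉ Z → x ≠ a i := fun x hx h => hx (h ▸ (haG i).2)
      have nb : ∀ x, x ∉ Z → x ≠ τ i.1.2 := fun x hx h => hx (h ▸ hτZ _)
      refine ⟨h1, h2, h3, na _ h1, nb _ h1, na _ h2, nb _ h2, ?_⟩
      rw [h4, h5, h6]
      exact hR'l i
    · intro i
      exact hroute Z hZ _ (haG i).1 _ (hτG _) (haG i).2 (hτZ _)
    · intro x
      by_cases hx : ∃ m, τ m = x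
      · obtain ⟨m, rfl⟩ := hx
        refine le_trans (Finset.card_le_card ?_) (Prs_fst t m)
        intro i hi
        simp only [Finset.mem_filter, Finset.mem_univ, true_and] at hi ⊢
        rcases ha i with h | h
        · exact τ.injective (h.symm.trans hi)
        · exact absurd (hi.symm.trans h) (hτβ _ _)
      · push Not at hx
        by_cases hx' : ∃ m, β m = x
        · obtain ⟨m, rfl⟩ := hx'
          refine le_trans (Finset.card_le_card_of_injOn (fun i : Prs t => i.1) ?_ ?_) (hRc m)
          · intro i hi
            simp only [Finset.coe_filter, Finset.mem_univ, true_and, Set.mem_ofPred_eq] at hi ⊢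
            rcases ha i with h | h
            · exact absurd (h.symm.trans hi) (hx _)
            · exact β.injective (h.symm.trans hi)
          · intro i _ j _ h
            exact Subtype.ext h
        · push Not at hx'
          rw [Finset.filter_false_of_mem]
          · simp
          · intro i _ h
            rcases ha i with h' | h'
            · exact hx _ (h'.symm.trans h)
            · exact hx' _ (h'.symm.trans h)

end Main

/-- For any fixed parity pattern σ on the edges of K_t, every finite simple
graph with no K_t-immersion of parity pattern σ has an edge set F with G[F] bipartite and
G ∖ F having no K_{98000·t + 4410071}-immersion. -/
theorem parity_pattern_immersion_free_decomposition {V : Type*} [Fintype V] (t : ℕ)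
    (ht : 1 ≤ t) (σ : Sym2 (Fin t) → ZMod 2) (G : SimpleGraph V)
    (h : ¬ HasParityPatternImmersion G t σ) :
    ∃ F ⊆ G.edgeSet, (SimpleGraph.fromEdgeSet F).Colorable 2 ∧
      ¬ HasImmersion (G.deleteEdges F) (⊤ : SimpleGraph (Fin (98000 * t + 4410071))) := by
  classical
  obtain ⟨col, hcut⟩ := max_cut G
  let Fg : SimpleGraph V :=
    { Adj := fun c d => G.Adj c d ∧ col c ≠ col d
      symm := ⟨fun c d h => ⟨h.1.symm, h.2.symm⟩⟩
      loopless := ⟨fun c h => h.2 rfl⟩ }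
  have hFG : Fg ≤ G := fun c d h => h.1
  refine ⟨Fg.edgeSet, edgeSet_mono hFG, ?_, ?_⟩
  · rw [SimpleGraph.fromEdgeSet_edgeSet]
    have := (SimpleGraph.Coloring.mk (G := Fg) col (fun h => h.2)).colorable
    simpa using this
  · rintro ⟨I⟩
    apply h
    have hle : G.deleteEdges Fg.edgeSet ≤ G := SimpleGraph.deleteEdges_le _
    have hsub : ∀ x y (hxy : (⊤ : SimpleGraph (Fin (98000 * t + 4410071))).Adj x y),
        ∀ e ∈ (I.trail hxy).edges, e ∈ G.edgeSet := fun x y hxy e he =>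
      edgeSet_mono hle ((I.trail hxy).edges_subset_edgeSet he)
    refine main_case G t ht σ (W := Fin (98000 * t + 4410071)) (by simp) col hcut I.φ
      (fun x y hxy => (I.trail (u := x) (v := y) hxy).transfer G (hsub x y hxy)) ?_ ?_ ?_ ?_
    · intro x y hxy
      rw [Walk.isTrail_def, Walk.edges_transfer]
      exact (I.isTrail _).edges_nodup
    · intro x y hxy
      have := I.symm (u := x) (v := y) hxy
      simp only [Walk.length_transfer]
      exact ((congrArg Walk.length this).trans (Walk.length_reverse _)).symm
    · intro x y z w h1 h2 hne
      simp only [Walk.edges_transfer]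
      exact I.disjoint _ _ hne
    · intro x y hxy c d hcd
      simp only [Walk.edges_transfer] at hcd
      have hadj := (I.trail (u := x) (v := y) hxy).adj_of_mem_edges hcd
      rw [SimpleGraph.deleteEdges_adj] at hadj
      by_contra hne
      exact hadj.2 ⟨hadj.1, hne⟩
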